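/- Sign determination in the index 2 case, form (2): assume f is odd and that the Gauss sum satisfies G(χ) = ε · g · p^{(f−1)/2}, where g = Σ_{t=1}^{p−1} (t/p) ζ_p^t is the quadratic Gauss sum over F_p and ε ∈ ℤ[ζ_{q−1}] is a root of unity. Then t(−n) · ε ≡ (−1)^{(f−1)/2} · ((p−1)/2)! (mod 𝔓). -/

import Mathlib

open NumberField

/-- The digit sum `S(a) = c₀ + ⋯ + c_{f−1}` of the base-`p` expansion of `a`. -/
def digitSum (p a : ℕ) : ℕ := (Nat.digits p a).sum

/-- The product `t(a) = c₀!·c₁!·⋯·c_{f−1}!` of the factorials of the base-`p`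
digits of `a`. -/
def digitFacProd (p a : ℕ) : ℕ := ((Nat.digits p a).map Nat.factorial).prod

theorem digitFacProd_add_mul {p : ℕ} (hp : 1 < p) {c : ℕ} (hc : c < p) (m : ℕ) :
    digitFacProd p (c + p * m) = c.factorial * digitFacProd p m := by
  rcases Nat.eq_zero_or_pos (c + p * m) with h | h
  · obtain ⟨rfl, hm⟩ := Nat.add_eq_zero_iff.mp h
    obtain rfl : m = 0 := (Nat.mul_eq_zero.mp hm).resolve_left (by omega)
    simp [digitFacProd]
  · rw [digitFacProd, Nat.digits_def' hp h, Nat.add_mul_mod_self_left, Nat.mod_eq_of_lt hc,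
      Nat.add_mul_div_left _ _ (by omega), Nat.div_eq_of_lt hc, zero_add]
    simp [digitFacProd]

theorem digitFacProd_of_lt {p a : ℕ} (hp : 1 < p) (ha : a < p) :
    digitFacProd p a = a.factorial := by
  simpa [digitFacProd] using digitFacProd_add_mul hp ha 0

theorem not_dvd_digitFacProd {p : ℕ} [Fact p.Prime] (a : ℕ) : ¬ p ∣ digitFacProd p a := by
  have hp : p.Prime := Fact.out
  rw [digitFacProd, hp.prime.dvd_prod_iff]
  rintro ⟨b, hb, hdvd⟩
  obtain ⟨c, hc, rfl⟩ := List.mem_map.mp hb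
  exact (Nat.digits_lt_base hp.one_lt hc).not_ge (hp.dvd_factorial.mp hdvd)

theorem FiniteField.sum_inv_pow_mul_inv_one_sub (F : Type*) [Field F] [Fintype F] {b : ℕ}
    (hb : 1 ≤ b) (hbq : b + 1 < Fintype.card F - 1) :
    ∑ x : F, x⁻¹ ^ b * (1 - x)⁻¹ = -((b + 1 : ℕ) : F) := by
  classical
  have h_inv : ∑ y : F, (y - 1)⁻¹ = 0 := by
    have h := Equiv.sum_comp (Equiv.subRight (1 : F)) (fun y ↦ y⁻¹)
    have h' := Equiv.sum_comp (Equiv.inv F) (fun y ↦ y)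
    simp only [Equiv.subRight_apply, Equiv.inv_apply] at h h'
    rw [h, h']
    simpa using FiniteField.sum_pow_lt_card_sub_one F 1 (by omega)
  have h_geom : ∑ y : F, ∑ i ∈ Finset.range (b + 1), y ^ i = 0 := by
    rw [Finset.sum_comm]
    refine Finset.sum_eq_zero fun i hi ↦ FiniteField.sum_pow_lt_card_sub_one F i ?_
    have := Finset.mem_range.mp hi
    omega
  have key (y : F) : y ^ b * (1 - y⁻¹)⁻¹ = (y - 1)⁻¹ + ∑ i ∈ Finset.range (b + 1), y ^ i
      - if y = 1 then ((b + 1 : ℕ) : F) else 0 := by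
    rcases eq_or_ne y 1 with rfl | hy1
    · simp
    · have hy1' : y - 1 ≠ 0 := sub_ne_zero.mpr hy1
      rw [geom_sum_eq hy1, if_neg hy1, sub_zero]
      rcases eq_or_ne y 0 with rfl | hy0
      · simp [show b ≠ 0 by omega]
      · have : (1 - y⁻¹)⁻¹ = y * (y - 1)⁻¹ := by
          rw [show 1 - y⁻¹ = (y - 1) * y⁻¹ by field_simp, mul_inv, inv_inv, mul_comm]
        rw [this]
        field_simp
        ring
  rw [← Equiv.sum_comp (Equiv.inv F)]
  simp only [Equiv.inv_apply, inv_inv, key, Finset.sum_sub_distrib, Finset.sum_add_distrib, h_inv,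
    h_geom, Finset.sum_ite_eq', Finset.mem_univ, if_true]
  ring

theorem FiniteField.trace_pow_prime {p : ℕ} [Fact p.Prime] {F : Type*} [Field F] [Fintype F]
    [Algebra (ZMod p) F] (x : F) :
    Algebra.trace (ZMod p) F (x ^ p) = Algebra.trace (ZMod p) F x := by
  simpa using Algebra.trace_eq_of_algEquiv
    (FiniteField.frobeniusAlgEquivOfAlgebraic (ZMod p) F) x

theorem FiniteField.sum_inv_mul_trace {p : ℕ} [Fact p.Prime] {F : Type*} [Field F] [Fintype F]
    [Algebra (ZMod p) F] :
    ∑ x : F, x⁻¹ * algebraMap (ZMod p) F (Algebra.trace (ZMod p) F x) = -1 := by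
  classical
  have hcard : Fintype.card F = p ^ Module.finrank (ZMod p) F := by
    simpa using Module.card_eq_pow_finrank (K := ZMod p) (V := F)
  have hpos : 0 < Module.finrank (ZMod p) F := Module.finrank_pos
  have hp := (Fact.out : p.Prime).one_lt
  have h_zero : ∑ x : F, x⁻¹ * x = -1 := by
    have (x : F) : x⁻¹ * x = 1 - if x = 0 then 1 else 0 := by
      split_ifs with h <;> simp [h]
    simp [this]
  simp_rw [FiniteField.algebraMap_trace_eq_sum_pow, Finset.mul_sum]
  rw [Finset.sum_comm, Finset.sum_eq_single_of_mem 0 (Finset.mem_range.mpr hpos)]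
  · simpa using h_zero
  · intro i hi hi0
    have h1 : 1 < p ^ i := Nat.one_lt_pow hi0 hp
    have h2 : p ^ i < Fintype.card F := by
      rw [hcard]
      exact Nat.pow_lt_pow_right hp (Finset.mem_range.mp hi)
    have (x : F) : x⁻¹ * x ^ Nat.card (ZMod p) ^ i = x ^ (p ^ i - 1) := by
      rw [Nat.card_zmod]
      rcases eq_or_ne x 0 with rfl | hx
      · simp [show p ^ i - 1 ≠ 0 by omega]
      · rw [inv_mul_eq_iff_eq_mul₀ hx, ← pow_succ', Nat.sub_add_cancel h1.le]
    simp_rw [this]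
    exact FiniteField.sum_pow_lt_card_sub_one F _ (by omega)

theorem map_eq_one_of_pow_prime_eq_one {p : ℕ} [Fact p.Prime] {R k : Type*} [CommRing R] [Field k]
    [CharP k p] (φ : R →+* k) {ζ : R} (hζ : ζ ^ p = 1) : φ ζ = 1 := by
  apply frobenius_inj k p
  simp [frobenius_def, ← map_pow, hζ]

/-- The additive character `x ↦ ζ ^ Tr(x)` of a finite field of characteristic `p`. -/
noncomputable def traceAddChar {p : ℕ} [Fact p.Prime] (F : Type*) [Field F] [Algebra (ZMod p) F]
    {R : Type*} [CommRing R] {ζ : R} (hζ : ζ ^ p = 1) : AddChar F R :=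
  (AddChar.zmodChar p hζ).compAddMonoidHom (Algebra.trace (ZMod p) F).toAddMonoidHom

theorem traceAddChar_apply {p : ℕ} [Fact p.Prime] {F : Type*} [Field F] [Algebra (ZMod p) F]
    {R : Type*} [CommRing R] {ζ : R} (hζ : ζ ^ p = 1) (x : F) :
    traceAddChar F hζ x = ζ ^ (Algebra.trace (ZMod p) F x).val :=
  rfl

theorem MulChar.map_inv_pow_apply {F R k : Type*} [Field F] [CommRing R] [Field k] {φ : R →+* k} {i : F →+* k} {ω : MulChar F R}
    (hω : ∀ x, φ (ω x) = i x) {b : ℕ} (hb : b ≠ 0) (x : F) :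
    φ ((ω⁻¹ ^ b) x) = i (x⁻¹ ^ b) := by
  rw [MulChar.pow_apply' _ hb, MulChar.inv_apply', map_pow, map_pow, hω]

section Stickelberger

variable {p : ℕ} [Fact p.Prime] {F : Type*} [Field F] [Fintype F] [Algebra (ZMod p) F]
  {R : Type*} [CommRing R] {k : Type*} [Field k]

theorem gaussSum_traceAddChar_pow_prime (χ : MulChar F R) {ζ : R} (hζ : ζ ^ p = 1) :
    gaussSum (χ ^ p) (traceAddChar F hζ) = gaussSum χ (traceAddChar F hζ) := by
  have hp := (Fact.out : p.Prime).ne_zero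
  have hbij : Function.Bijective (fun x : F ↦ x ^ p) := by
    simpa using (FiniteField.frobeniusAlgEquivOfAlgebraic (ZMod p) F).bijective
  rw [gaussSum, gaussSum, ← Function.Bijective.sum_comp hbij (fun x ↦ χ x * traceAddChar F hζ x)]
  refine Finset.sum_congr rfl fun x _ ↦ ?_
  rw [MulChar.pow_apply' _ hp, map_pow, traceAddChar_apply, traceAddChar_apply,
    FiniteField.trace_pow_prime]

theorem MulChar.inv_pow_ne_one_of_lt {φ : R →+* k} {i : F →+* k} {ω : MulChar F R}
    (hω : ∀ x, φ (ω x) = i x) {b : ℕ} (hb : b ≠ 0) (hbq : b < Fintype.card F - 1) :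
    ω⁻¹ ^ b ≠ 1 := by
  intro h
  refine hbq.not_ge (Nat.le_of_dvd (Nat.pos_of_ne_zero hb)
    ((FiniteField.forall_pow_eq_one_iff F b).mp fun x ↦ ?_))
  have := MulChar.map_inv_pow_apply hω hb ((x⁻¹ : Fˣ) : F)
  rw [h, MulChar.one_apply_coe, map_one] at this
  ext
  apply i.injective
  simpa using this.symm

theorem exists_gaussSum_inv_eq [IsDomain R] {φ : R →+* k} {i : F →+* k} {ω : MulChar F R}
    (hω : ∀ x, φ (ω x) = i x) {ζ : R} (hζ : ζ ^ p = 1) (hF : 2 < Fintype.card F) :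
    ∃ u, -gaussSum ω⁻¹ (traceAddChar F hζ) = (ζ - 1) * u ∧ φ u = 1 := by
  have : CharP k p := (i.comp (algebraMap (ZMod p) F)).charP_iff_charP p |>.mp inferInstance
  have hω1 : ω⁻¹ ≠ 1 := by simpa using MulChar.inv_pow_ne_one_of_lt hω one_ne_zero (by omega)
  have hζ1 : φ ζ = 1 := map_eq_one_of_pow_prime_eq_one φ hζ
  refine ⟨-∑ x : F, ω⁻¹ x * ∑ j ∈ Finset.range (Algebra.trace (ZMod p) F x).val, ζ ^ j, ?_, ?_⟩
  · rw [mul_neg, Finset.mul_sum, ← sub_zero (gaussSum _ _),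
      ← MulChar.sum_eq_zero_of_ne_one hω1, gaussSum, ← Finset.sum_sub_distrib]
    congr 1
    refine Finset.sum_congr rfl fun x _ ↦ ?_
    rw [mul_left_comm, mul_geom_sum, traceAddChar_apply]
    ring
  · have (x : F) : φ (ω⁻¹ x * ∑ j ∈ Finset.range (Algebra.trace (ZMod p) F x).val, ζ ^ j) =
        i (x⁻¹ * algebraMap (ZMod p) F (Algebra.trace (ZMod p) F x)) := by
      have h : algebraMap (ZMod p) F (Algebra.trace (ZMod p) F x) =
          ((Algebra.trace (ZMod p) F x).val : F) := by
        conv_lhs => rw [← ZMod.natCast_zmod_val (Algebra.trace (ZMod p) F x)]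
        rw [map_natCast]
      rw [h, map_mul, map_mul, MulChar.inv_apply', hω]
      simp only [map_sum, map_pow, hζ1, one_pow, Finset.sum_const, Finset.card_range, nsmul_eq_mul,
        mul_one, map_natCast]
    rw [map_neg, map_sum, Finset.sum_congr rfl fun x _ ↦ this x, ← map_sum,
      FiniteField.sum_inv_mul_trace]
    simp

theorem map_jacobiSum_inv_pow_inv {φ : R →+* k} {i : F →+* k} {ω : MulChar F R}
    (hω : ∀ x, φ (ω x) = i x) {b : ℕ} (hb : b ≠ 0) (hbq : b + 1 < Fintype.card F - 1) :
    φ (jacobiSum (ω⁻¹ ^ b) ω⁻¹) = -((b + 1 : ℕ) : k) := by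
  have h (x : F) : φ ((ω⁻¹ ^ b) x * ω⁻¹ (1 - x)) = i (x⁻¹ ^ b * (1 - x)⁻¹) := by
    rw [map_mul, MulChar.map_inv_pow_apply hω hb, MulChar.inv_apply', hω, map_mul]
  rw [jacobiSum, map_sum, Finset.sum_congr rfl fun x _ ↦ h x, ← map_sum,
    FiniteField.sum_inv_pow_mul_inv_one_sub F (by omega) hbq]
  simp

/-- The **Stickelberger congruence** for Gauss sums, with denominators cleared. -/
theorem exists_gaussSum_inv_pow_mul_eq [IsDomain R] {φ : R →+* k} {i : F →+* k} {ω : MulChar F R}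
    (hω : ∀ x, φ (ω x) = i x) {ζ : R} (hζ : ζ ^ p = 1) (a : ℕ) (ha : a ≠ 0)
    (haq : a < Fintype.card F - 1) :
    ∃ (s : ℕ) (K u : R), -gaussSum (ω⁻¹ ^ a) (traceAddChar F hζ) * K = (ζ - 1) ^ s * u ∧
      φ K = digitFacProd p a ∧ φ u = 1 := by
  have hchar : CharP k p := (i.comp (algebraMap (ZMod p) F)).charP_iff_charP p |>.mp inferInstance
  have hp := (Fact.out : p.Prime).one_lt
  induction a using Nat.strong_induction_on with
  | _ a ih =>
    obtain ⟨m, c, hc, rfl⟩ : ∃ m c, c < p ∧ a = c + p * m :=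
      ⟨a / p, a % p, Nat.mod_lt _ (by omega), (Nat.mod_add_div a p).symm⟩
    rcases Nat.eq_zero_or_pos c with rfl | hc0
    · have hm : m ≠ 0 := by rintro rfl; simp at ha
      have hlt : m < 0 + p * m := by nlinarith [Nat.pos_of_ne_zero hm]
      obtain ⟨s, K, u, h1, h2, h3⟩ := ih m hlt hm (by omega)
      refine ⟨s, K, u, ?_, ?_, h3⟩
      · rw [zero_add, mul_comm p, pow_mul, gaussSum_traceAddChar_pow_prime, h1]
      · rw [h2, digitFacProd_add_mul hp hc, Nat.factorial_zero, one_mul]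
    · obtain ⟨c, rfl⟩ := Nat.exists_eq_add_of_lt hc0
      rw [zero_add] at *
      obtain ⟨v, hv1, hv2⟩ := exists_gaussSum_inv_eq hω hζ (by omega)
      rcases eq_or_ne (c + p * m) 0 with h0 | h0
      · obtain ⟨rfl, hm⟩ := Nat.add_eq_zero_iff.mp h0
        refine ⟨1, 1, v, ?_, ?_, hv2⟩
        · simp [hm, hv1]
        · rw [hm, digitFacProd_of_lt hp (by omega)]
          simp
      · obtain ⟨s, K, u, h1, h2, h3⟩ := ih (c + p * m) (by omega) h0 (by omega)
        have hJ := map_jacobiSum_inv_pow_inv hω h0 (by omega)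
        have hne := MulChar.inv_pow_ne_one_of_lt hω ha haq
        rw [show c + 1 + p * m = c + p * m + 1 by ring, pow_succ] at hne
        have hG := jacobiSum_mul_nontrivial hne (traceAddChar F hζ)
        refine ⟨s + 1, -jacobiSum (ω⁻¹ ^ (c + p * m)) ω⁻¹ * K, u * v, ?_, ?_, ?_⟩
        · rw [show c + 1 + p * m = c + p * m + 1 by ring, pow_succ (ω⁻¹)]
          linear_combination K * hG + (ζ - 1) * v * h1
            - K * gaussSum (ω⁻¹ ^ (c + p * m)) (traceAddChar F hζ) * hv1
        · rw [map_mul, map_neg, hJ, h2, digitFacProd_add_mul hp hc,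
            digitFacProd_add_mul hp (by omega), Nat.factorial_succ]
          push_cast
          rw [CharP.cast_eq_zero k p]
          ring
        · rw [map_mul, h3, hv2, one_mul]

end Stickelberger

theorem exists_mulChar_eq_of_pow_eq_one {R κ : Type*} [CommRing R] [IsDomain R] [Field κ]
    [Fintype κ] (φ : R →+* κ) (ω : κ → R) (hω0 : ω 0 = 0)
    (hωroot : ∀ t, t ≠ 0 → ω t ^ (Fintype.card κ - 1) = 1) (hω : ∀ t, φ (ω t) = t) :
    ∃ χ : MulChar κ R, ∀ t, χ t = ω t := by
  classical
  have hpos : 0 < Fintype.card κ - 1 := Nat.sub_pos_of_lt Fintype.one_lt_card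
  have himage : (Finset.univ.erase (0 : κ)).image ω =
      Polynomial.nthRootsFinset (Fintype.card κ - 1) (1 : R) := by
    refine Finset.eq_of_subset_of_card_le (fun r hr ↦ ?_) ?_
    · obtain ⟨t, ht, rfl⟩ := Finset.mem_image.mp hr
      exact (Polynomial.mem_nthRootsFinset hpos 1).mpr (hωroot t (Finset.ne_of_mem_erase ht))
    · rw [Finset.card_image_of_injective _ (Function.LeftInverse.injective hω),
        Finset.card_erase_of_mem (Finset.mem_univ _), Finset.card_univ]
      exact (Multiset.toFinset_card_le _).trans (Polynomial.card_nthRoots _ _)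
  have hfix (r : R) (hr : r ^ (Fintype.card κ - 1) = 1) : ω (φ r) = r := by
    rw [← Polynomial.mem_nthRootsFinset hpos 1, ← himage] at hr
    obtain ⟨t, -, rfl⟩ := Finset.mem_image.mp hr
    rw [hω]
  refine ⟨{ toFun := ω, map_one' := ?_, map_mul' := fun s t ↦ ?_, map_nonunit' := ?_ },
    fun _ ↦ rfl⟩
  · simpa using hfix 1 (one_pow _)
  · rcases eq_or_ne s 0 with rfl | hs
    · simp [hω0]
    rcases eq_or_ne t 0 with rfl | ht
    · simp [hω0]
    simpa [hω] using hfix (ω s * ω t) (by rw [mul_pow, hωroot s hs, hωroot t ht, one_mul])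
  · intro t ht
    obtain rfl : t = 0 := by simpa [isUnit_iff_ne_zero] using ht
    exact hω0

/-- The pullback of a multiplicative character along a homomorphism of fields. -/
def MulChar.comapField {K F R : Type*} [Field K] [Field F] [CommRing R] (χ : MulChar F R)
    (i : K →+* F) : MulChar K R where
  toMonoidHom := χ.toMonoidHom.comp (i : K →* F)
  map_nonunit' a ha := by
    obtain rfl : a = 0 := by simpa [isUnit_iff_ne_zero] using ha
    exact (congrArg χ (map_zero i)).trans χ.map_zero

theorem IsPrimitiveRoot.exists_prime_eq_sub_one_pow_mul {p : ℕ} [Fact p.Prime] {R k : Type*}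
    [CommRing R] [IsDomain R] [Field k] [CharP k p] (hodd : Odd p) (φ : R →+* k) {ζ : R}
    (hζ : IsPrimitiveRoot ζ p) : ∃ w, (p : R) = (ζ - 1) ^ (p - 1) * w ∧ φ w = -1 := by
  have hp : p - 1 + 1 = p := Nat.sub_add_cancel (Fact.out : p.Prime).one_le
  have heven : Even (p - 1) := Nat.Odd.sub_odd hodd odd_one
  have h := (hp ▸ hζ : IsPrimitiveRoot ζ (p - 1 + 1)).prod_pow_sub_one_eq_order
  refine ⟨∏ j ∈ Finset.range (p - 1), ∑ l ∈ Finset.range (j + 1), ζ ^ l, ?_, ?_⟩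
  · rw [heven.neg_one_pow, one_mul, ← Nat.cast_add_one, hp] at h
    simp_rw [← h, ← mul_geom_sum, Finset.prod_mul_distrib, Finset.prod_const, Finset.card_range]
  · have hw : ((p - 1).factorial : k) = -1 := by
      have := congrArg (ZMod.castHom dvd_rfl k) (ZMod.wilsons_lemma p)
      rwa [map_natCast, map_neg, map_one] at this
    rw [← hw, ← Finset.prod_range_add_one_eq_factorial]
    simp only [Nat.cast_prod]
    simp [map_eq_one_of_pow_prime_eq_one φ hζ.pow_eq_one]

theorem inv_pow_half_eq_quadraticChar {p : ℕ} [Fact p.Prime] {R k : Type*} [CommRing R]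
    [IsDomain R] [Field k] (hodd : Odd p) {φ : R →+* k} {i : ZMod p →+* k} {ω : MulChar (ZMod p) R}
    (hω : ∀ x, φ (ω x) = i x) :
    ω⁻¹ ^ ((p - 1) / 2) = (quadraticChar (ZMod p)).ringHomComp (Int.castRingHom R) := by
  have hchar : CharP k p := i.charP_iff_charP p |>.mp inferInstance
  have hp2 : p ≠ 2 := by rintro rfl; exact absurd hodd (by decide)
  have hp := (Fact.out : p.Prime).two_le
  have hk : (2 : k) ≠ 0 := Ring.two_ne_zero (by rwa [ringChar.eq k p])
  have hhalf : (p - 1) / 2 = p / 2 := by grind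
  have hh0 : (p - 1) / 2 ≠ 0 := by omega
  ext x
  have h2h : (p - 1) / 2 * 2 = p - 1 :=
    Nat.div_mul_cancel (Nat.Odd.sub_odd hodd odd_one).two_dvd
  set A := (ω⁻¹ ^ ((p - 1) / 2)) (x : ZMod p)
  set B := (quadraticChar (ZMod p)).ringHomComp (Int.castRingHom R) (x : ZMod p) with hB
  have hA2 : A * A = 1 := by
    rw [← sq, ← MulChar.pow_apply_coe, ← pow_mul, h2h]
    have := MulChar.pow_card_eq_one (ω⁻¹)
    rw [ZMod.card_units_eq_totient, Nat.totient_prime Fact.out] at this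
    rw [this, MulChar.one_apply_coe]
  have hB2 : B * B = 1 := by
    rw [hB, MulChar.ringHomComp_apply, ← map_mul, ← sq, quadraticChar_sq_one x.ne_zero, map_one]
  have hAB : φ A = φ B := by
    rw [MulChar.map_inv_pow_apply hω hh0, hB, MulChar.ringHomComp_apply]
    have := quadraticChar_eq_pow_of_char_ne_two' (F := ZMod p)
      (by rwa [ZMod.ringChar_zmod_n]) (x : ZMod p)
    have hinv : (x : ZMod p)⁻¹ ^ ((p - 1) / 2) = (x : ZMod p) ^ ((p - 1) / 2) := by
      rw [inv_pow]
      refine inv_eq_of_mul_eq_one_left ?_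
      rw [← pow_add, ← mul_two, h2h]
      exact ZMod.pow_card_sub_one_eq_one x.ne_zero
    rw [ZMod.card] at this
    rw [hinv, hhalf, ← this]
    simp
  rcases mul_self_eq_one_iff.mp hA2 with hA | hA <;>
    rcases mul_self_eq_one_iff.mp hB2 with hB' | hB' <;> rw [hA, hB'] at hAB ⊢
  · simp only [map_one, map_neg] at hAB
    exact absurd (by linear_combination hAB) hk
  · simp only [map_one, map_neg] at hAB
    exact absurd (by linear_combination -hAB) hk

theorem gaussSum_quadraticChar_eq_sum_legendreSym {p : ℕ} [Fact p.Prime] {R : Type*} [CommRing R]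
    {ζ : R} (hζ : ζ ^ p = 1) :
    gaussSum ((quadraticChar (ZMod p)).ringHomComp (Int.castRingHom R)) (traceAddChar (ZMod p) hζ) =
      ∑ t ∈ Finset.Icc 1 (p - 1), (legendreSym p (t : ℤ) : R) * ζ ^ t := by
  have hp := (Fact.out : p.Prime).pos
  rw [gaussSum, ← Finset.sum_erase (a := (0 : ZMod p)) _ (by simp)]
  refine Finset.sum_nbij' ZMod.val (fun t ↦ (t : ZMod p)) (fun x hx ↦ ?_) (fun t ht ↦ ?_)
    (fun x _ ↦ ZMod.natCast_zmod_val x) (fun t ht ↦ ?_) (fun x _ ↦ ?_)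
  · have := ZMod.val_lt x
    have := (ZMod.val_ne_zero x).mpr (Finset.ne_of_mem_erase hx)
    rw [Finset.mem_Icc]
    omega
  · rw [Finset.mem_Icc] at ht
    refine Finset.mem_erase.mpr ⟨fun h ↦ ?_, Finset.mem_univ _⟩
    rw [ZMod.natCast_eq_zero_iff] at h
    exact absurd (Nat.le_of_dvd (by omega) h) (by omega)
  · rw [Finset.mem_Icc] at ht
    exact ZMod.val_natCast_of_lt (by omega)
  · rw [traceAddChar_apply, Algebra.trace_self_apply, MulChar.ringHomComp_apply, legendreSym]
    simp

theorem map_eq_map_of_pow_mul_eq_pow_mul {R k : Type*} [CommRing R] [IsDomain R] [Field k]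
    (φ : R →+* k) {ϖ A B : R} {s m : ℕ} (hϖ0 : ϖ ≠ 0) (hϖ : φ ϖ = 0) (hA : φ A ≠ 0)
    (hB : φ B ≠ 0) (h : ϖ ^ s * A = ϖ ^ m * B) : φ A = φ B := by
  wlog hsm : s ≤ m generalizing s m A B
  · exact (this hB hA h.symm (le_of_not_ge hsm)).symm
  obtain ⟨d, rfl⟩ := Nat.exists_eq_add_of_le hsm
  rw [pow_add, mul_assoc] at h
  have h_map := congrArg φ (mul_left_cancel₀ (pow_ne_zero s hϖ0) h)
  rcases eq_or_ne d 0 with rfl | hd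
  · simpa using h_map
  · simp [hϖ, hd, hA] at h_map

/-- **Sign determination in the index 2 case, form (2): `G(χ) = ε·g·p^((f−1)/2)`.**
Let `p` be an odd prime, `N ≥ 2` with `gcd(N,p) = 1`, `f` the order of `p` mod `N`
(assumed odd), `q = p^f`, `n = (q−1)/N`.  Let `E = ℚ(ζ_{q−1}, ζ_p)`, `𝔓` the prime of
`𝓞 E` above `p` with residue field `F_q`, `ω` the Teichmüller map, `χ = ω^n` and
`G(χ) = ∑_{x ≠ 0} ω(x)^n ζp^{T(x)}` the Gauss sum; let
`g = ∑_{t=1}^{p−1} (t/p) ζp^t` be the quadratic Gauss sum over `F_p` (so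
`g = √(p*)`, `p* = (−1)^((p−1)/2) p`).  If `G(χ) = ε·g·p^((f−1)/2)` for some root of
unity `ε`, then `t(−n)·ε ≡ (−1)^((f−1)/2)·((p−1)/2)! (mod 𝔓)`. -/
theorem sign_determination_index_two_form_two
    (p N f q n : ℕ) [Fact p.Prime] (hodd : Odd p)
    (hN : 2 ≤ N) (hNp : Nat.Coprime N p)
    (hf : orderOf (p : ZMod N) = f) (hq : q = p ^ f) (hn : n = (q - 1) / N)
    (hfodd : Odd f)
    (E : Type) [Field E] [NumberField E]
    (ζ ζp : 𝓞 E)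
    (hζ : IsPrimitiveRoot ζ (q - 1)) (hζp : IsPrimitiveRoot ζp p)
    (hgen : Algebra.adjoin ℚ {(ζ : E), (ζp : E)} = ⊤)
    (𝔓 : Ideal (𝓞 E)) (hprime : 𝔓.IsPrime) (hp𝔓 : (p : 𝓞 E) ∈ 𝔓)
    [Fintype (𝓞 E ⧸ 𝔓)] [DecidableEq (𝓞 E ⧸ 𝔓)]
    (hcard : Fintype.card (𝓞 E ⧸ 𝔓) = q)
    [Algebra (ZMod p) (𝓞 E ⧸ 𝔓)]
    (ω : (𝓞 E ⧸ 𝔓) → 𝓞 E)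
    (hω0 : ω 0 = 0)
    (hωroot : ∀ t : 𝓞 E ⧸ 𝔓, t ≠ 0 → ω t ^ (q - 1) = 1)
    (hωlift : ∀ t : 𝓞 E ⧸ 𝔓, Ideal.Quotient.mk 𝔓 (ω t) = t)
    (ε : 𝓞 E) (hε : ∃ m : ℕ, 0 < m ∧ ε ^ m = 1)
    (hG : (∑ x ∈ Finset.univ.filter (fun x : 𝓞 E ⧸ 𝔓 => x ≠ 0),
        ω x ^ n * ζp ^ (Algebra.trace (ZMod p) (𝓞 E ⧸ 𝔓) x).val)
      = ε * (∑ t ∈ Finset.Icc 1 (p - 1), (legendreSym p (t : ℤ) : 𝓞 E) * ζp ^ t) *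
          (p : 𝓞 E) ^ ((f - 1) / 2)) :
    (digitFacProd p (q - 1 - n) : 𝓞 E) * ε -
      (-1) ^ ((f - 1) / 2) * (((p - 1) / 2).factorial : 𝓞 E) ∈ 𝔓 := by
  have hp := (Fact.out : p.Prime).two_le
  have hp2 : p ≠ 2 := by rintro rfl; exact absurd hodd (by decide)
  have hf0 : 0 < f := hfodd.pos
  have hpq : p ≤ q := hq ▸ Nat.le_self_pow hf0.ne' p
  have hNq : N ∣ q - 1 := by
    have h : ((q - 1 : ℕ) : ZMod N) = 0 := by
      rw [Nat.cast_sub (by omega), hq, Nat.cast_pow, ← hf, pow_orderOf_eq_one]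
      simp
    exact (ZMod.natCast_eq_zero_iff _ _).mp h
  have hn0 : 0 < n := hn ▸ Nat.div_pos (Nat.le_of_dvd (by omega) hNq) (by omega)
  have hnq : n < q - 1 := hn ▸ Nat.div_lt_self (by omega) hN
  have hmax : 𝔓.IsMaximal := Ideal.Quotient.maximal_of_isField 𝔓 (Finite.isField_of_domain _)
  let _ : Field (𝓞 E ⧸ 𝔓) := Ideal.Quotient.field 𝔓
  have hchar : CharP (𝓞 E ⧸ 𝔓) p :=
    (algebraMap (ZMod p) (𝓞 E ⧸ 𝔓)).charP_iff_charP p |>.mp inferInstance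
  obtain ⟨χ, hχ⟩ := exists_mulChar_eq_of_pow_eq_one (Ideal.Quotient.mk 𝔓) ω hω0
    (by rwa [hcard]) hωlift
  have hχlift (x) : Ideal.Quotient.mk 𝔓 (χ x) = RingHom.id (𝓞 E ⧸ 𝔓) x := by
    rw [hχ, hωlift, RingHom.id_apply]
  have hχn : χ⁻¹ ^ (q - 1 - n) = χ ^ n := by
    rw [inv_pow, inv_eq_iff_mul_eq_one, ← pow_add, Nat.sub_add_cancel hnq.le, ← hcard,
      ← Fintype.card_units]
    exact χ.pow_card_eq_one
  have hsum : gaussSum (χ⁻¹ ^ (q - 1 - n)) (traceAddChar (𝓞 E ⧸ 𝔓) hζp.pow_eq_one) =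
      ∑ x ∈ Finset.univ.filter (fun x : 𝓞 E ⧸ 𝔓 => x ≠ 0),
        ω x ^ n * ζp ^ (Algebra.trace (ZMod p) (𝓞 E ⧸ 𝔓) x).val := by
    rw [hχn, gaussSum, Finset.sum_filter_of_ne]
    · refine Finset.sum_congr rfl fun x _ ↦ ?_
      rw [MulChar.pow_apply' _ hn0.ne', hχ]
      rfl
    · rintro x - hx rfl
      simp [hω0, hn0.ne'] at hx
  obtain ⟨s, K, u, h1, hK, hu⟩ := exists_gaussSum_inv_pow_mul_eq hχlift hζp.pow_eq_one
    (q - 1 - n) (by omega) (by omega)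
  let χp := χ.comapField (algebraMap (ZMod p) (𝓞 E ⧸ 𝔓))
  have hχp (x) : Ideal.Quotient.mk 𝔓 (χp x) = algebraMap (ZMod p) (𝓞 E ⧸ 𝔓) x := hχlift _
  obtain ⟨m, L, v, h2, hL, hv⟩ := exists_gaussSum_inv_pow_mul_eq hχp hζp.pow_eq_one
    ((p - 1) / 2) (by omega) (by rw [ZMod.card]; omega)
  rw [inv_pow_half_eq_quadraticChar hodd hχp, gaussSum_quadraticChar_eq_sum_legendreSym] at h2
  rw [digitFacProd_of_lt (by omega) (by omega)] at hL
  obtain ⟨w, h3, hw⟩ := hζp.exists_prime_eq_sub_one_pow_mul hodd (Ideal.Quotient.mk 𝔓)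
  rw [hsum, hG] at h1
  have hε0 : Ideal.Quotient.mk 𝔓 ε ≠ 0 := by
    obtain ⟨l, hl, hεl⟩ := hε
    intro h
    have := congrArg (Ideal.Quotient.mk 𝔓) hεl
    rw [map_pow, h, zero_pow hl.ne', map_one] at this
    exact zero_ne_one this
  have hK0 : Ideal.Quotient.mk 𝔓 K ≠ 0 := by
    rw [hK, Ne, CharP.cast_eq_zero_iff _ p]
    exact not_dvd_digitFacProd _
  have hL0 : Ideal.Quotient.mk 𝔓 L ≠ 0 := by
    rw [hL, Ne, CharP.cast_eq_zero_iff _ p, (Fact.out : p.Prime).dvd_factorial]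
    omega
  have hkey : (ζp - 1) ^ s * (u * L) =
      (ζp - 1) ^ (m + (p - 1) * ((f - 1) / 2)) * (v * w ^ ((f - 1) / 2) * K * ε) := by
    have h3' : (p : 𝓞 E) ^ ((f - 1) / 2) =
        (ζp - 1) ^ ((p - 1) * ((f - 1) / 2)) * w ^ ((f - 1) / 2) := by
      rw [h3, mul_pow, pow_mul]
    rw [h3'] at h1
    rw [pow_add]
    linear_combination -L * h1 +
      ε * K * (ζp - 1) ^ ((p - 1) * ((f - 1) / 2)) * w ^ ((f - 1) / 2) * h2
  have hζp1 : ζp - 1 ≠ 0 := sub_ne_zero.mpr (hζp.ne_one (by omega))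
  have hϖ : Ideal.Quotient.mk 𝔓 (ζp - 1) = 0 := by
    rw [map_sub, map_eq_one_of_pow_prime_eq_one _ hζp.pow_eq_one, map_one, sub_self]
  have hfin := map_eq_map_of_pow_mul_eq_pow_mul (Ideal.Quotient.mk 𝔓) hζp1 hϖ
    (by simpa [hu] using hL0) (by simp [hv, hw, hK0, hε0]) hkey
  simp only [map_mul, map_pow, hu, hL, hv, hw, hK, one_mul] at hfin
  rw [← Ideal.Quotient.eq_zero_iff_mem]
  simp only [map_sub, map_mul, map_pow, map_neg, map_one, map_natCast, hfin]
  have hsq : (-1 : 𝓞 E ⧸ 𝔓) ^ ((f - 1) / 2) * (-1) ^ ((f - 1) / 2) = 1 := by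
    rw [← mul_pow]; simp
  linear_combination -(digitFacProd p (q - 1 - n) : 𝓞 E ⧸ 𝔓) * Ideal.Quotient.mk 𝔓 ε * hsq
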